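/- Let G = (V, E) be a loopless multigraph with no isolated vertices, V = {v_1, …, v_n}, E = {e_1, …, e_m}, and let F(G, ω) = ∏_{i=1}^{n} ( ∑_{e_j ∈ E_G(v_i)} y_j ). Then G has a perfect matching if and only if n is even and the expansion of F(G, ω) contains a monomial of the form y_{i_1}² y_{i_2}² ⋯ y_{i_{n/2}}² with i_1, …, i_{n/2} pairwise distinct; moreover each such monomial corresponds to the perfect matching {e_{i_1}, …, e_{i_{n/2}}}. -/

import Mathlib

/-- A loopless undirected multigraph with vertex type `V` and edge type `E`:
every edge `e` is assigned an unordered pair `G.inc e` of two *distinct*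
endpoints (parallel edges are allowed since `E` is an abstract edge type). -/
structure Multigraph (V : Type) (E : Type) where
  inc : E → Sym2 V
  loopless : ∀ e : E, ¬ (inc e).IsDiag

namespace Multigraph

variable {V E : Type}

/-- A set of edges is a matching if its edges are pairwise non-adjacent
(no two of them share an endpoint). -/
def IsMatching (G : Multigraph V E) (M : Set E) : Prop :=
  ∀ e ∈ M, ∀ f ∈ M, e ≠ f → ∀ v : V, ¬(v ∈ G.inc e ∧ v ∈ G.inc f)

/-- A set of edges is an edge cover if every vertex is incident with at
least one edge of the set. -/
def IsEdgeCover (G : Multigraph V E) (C : Set E) : Prop :=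
  ∀ v : V, ∃ e ∈ C, v ∈ G.inc e

/-- `f : V → E` is a choice of one incident edge for every vertex; these
choices index the monomials in the expansion of
`F(G,ω) = ∏_{v} ∑_{e ∈ E_G(v)} y_e`: the monomial of `f` is
`∏_v y_{f v}`, in which the exponent of an edge `e` is the number of
vertices `v` with `f v = e`, i.e. `{v | f v = e}.ncard`. -/
def IsChoice (G : Multigraph V E) (f : V → E) : Prop :=
  ∀ v : V, v ∈ G.inc (f v)

/-- A perfect matching: a matching covering every vertex. -/
def IsPerfectMatching (G : Multigraph V E) (M : Set E) : Prop :=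
  G.IsMatching M ∧ ∀ v : V, ∃ e ∈ M, v ∈ G.inc e

theorem ncard_setOf_mem_of_not_isDiag {z : Sym2 V} (hz : ¬ z.IsDiag) :
    {v : V | v ∈ z}.ncard = 2 := by
  induction z with
  | _ a b =>
    have h : {v : V | v ∈ s(a, b)} = {a, b} := by
      ext v
      simp
    rw [h]
    exact Set.ncard_pair hz

theorem even_card_of_even_ncard_fiber [Fintype V] [Fintype E] (f : V → E)
    (hf : ∀ e : E, Even {v : V | f v = e}.ncard) : Even (Fintype.card V) := by
  classical
  have h : Fintype.card V = ∑ e : E, {v : V | f v = e}.ncard := by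
    rw [← Finset.card_univ,
      Finset.card_eq_sum_card_fiberwise (f := f) (t := Finset.univ) (fun _ _ => by simp)]
    refine Finset.sum_congr rfl fun e _ => ?_
    rw [← Set.ncard_coe_finset]
    simp
  rw [h]
  exact Finset.even_sum _ fun e _ => hf e

theorem IsPerfectMatching.exists_isChoice {G : Multigraph V E} {M : Set E}
    (hM : G.IsPerfectMatching M) :
    ∃ f : V → E, G.IsChoice f ∧
      ∀ e : E, {v : V | f v = e}.ncard = 0 ∨ {v : V | f v = e}.ncard = 2 := by
  choose f hfM hf using hM.2
  refine ⟨f, hf, fun e => ?_⟩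
  by_cases he : e ∈ M
  · right
    have h : {v : V | f v = e} = {v : V | v ∈ G.inc e} := by
      ext v
      refine ⟨fun hv => hv ▸ hf v, fun hv => ?_⟩
      by_contra hne
      exact hM.1 _ (hfM v) _ he hne v ⟨hf v, hv⟩
    rw [h, ncard_setOf_mem_of_not_isDiag (G.loopless e)]
  · left
    have h : {v : V | f v = e} = ∅ := by
      ext v
      exact ⟨fun hv => he (hv ▸ hfM v), fun hv => hv.elim⟩
    rw [h, Set.ncard_empty]

theorem IsChoice.isPerfectMatching_range [Finite V] {G : Multigraph V E} {f : V → E}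
    (hf : G.IsChoice f)
    (hcard : ∀ e : E, {v : V | f v = e}.ncard = 0 ∨ {v : V | f v = e}.ncard = 2) :
    G.IsPerfectMatching (Set.range f) := by
  have key : ∀ u v : V, v ∈ G.inc (f u) → f v = f u := by
    intro u v hv
    have hne : {w : V | f w = f u}.ncard ≠ 0 :=
      Set.ncard_ne_zero_of_mem (show u ∈ {w : V | f w = f u} from rfl)
    have hsub : {w : V | f w = f u} ⊆ {w : V | w ∈ G.inc (f u)} :=
      fun w (hw : f w = f u) => hw ▸ hf w
    have heq := Set.eq_of_subset_of_ncard_le hsub <| by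
      rw [ncard_setOf_mem_of_not_isDiag (G.loopless _), (hcard (f u)).resolve_left hne]
    exact heq.ge hv
  refine ⟨?_, fun v => ⟨f v, ⟨v, rfl⟩, hf v⟩⟩
  rintro _ ⟨a, rfl⟩ _ ⟨b, rfl⟩ hne v ⟨ha, hb⟩
  exact hne ((key a v ha).symm.trans (key b v hb))

/-- For a loopless multigraph `G` without isolated vertices: `G` has a
perfect matching if and only if `n = |V|` is even and the expansion of
`F(G,ω) = ∏_{v} ∑_{e ∈ E_G(v)} y_e` contains a monomial `∏_v y_{f v}` in
which every occurring edge occurs squared (i.e. every edge is chosen by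
either `0` or `2` vertices); moreover each such monomial corresponds to
the perfect matching consisting of its (pairwise distinct) squared
edges, namely `Set.range f`. -/
theorem perfectMatching_iff_square_monomial
    {V E : Type} [Fintype V] [Fintype E]
    (G : Multigraph V E) (hiso : ∀ v : V, ∃ e : E, v ∈ G.inc e) :
    ((∃ M : Set E, G.IsPerfectMatching M) ↔
      (Even (Fintype.card V) ∧ ∃ f : V → E, G.IsChoice f ∧
        ∀ e : E, {v : V | f v = e}.ncard = 0 ∨ {v : V | f v = e}.ncard = 2)) ∧
    ∀ f : V → E, G.IsChoice f →
      (∀ e : E, {v : V | f v = e}.ncard = 0 ∨ {v : V | f v = e}.ncard = 2) →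
      G.IsPerfectMatching (Set.range f) := by
  refine ⟨⟨?_, ?_⟩, fun f hf hcard => hf.isPerfectMatching_range hcard⟩
  · rintro ⟨M, hM⟩
    obtain ⟨f, hf, hcard⟩ := hM.exists_isChoice
    refine ⟨even_card_of_even_ncard_fiber f fun e => ?_, f, hf, hcard⟩
    rcases hcard e with h | h <;> simp [h]
  · rintro ⟨-, f, hf, hcard⟩
    exact ⟨Set.range f, hf.isPerfectMatching_range hcard⟩

end Multigraph
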